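/- arXiv:2401.00673 — 3 statements merged into one kernel-verified Lean document; each statement's English description precedes it below -/
import Mathlib

section
/- Let 0 ≤ a ≤ b, let ω be a control on [a,b], and let s = t₀ < t₁ < ⋯ < t_N = t be a partition of a subinterval [s,t] ⊆ [a,b] with N ≥ 2. Then there exists an index i ∈ {1, …, N−1} such that ω(t_{i−1}, t_{i+1}) ≤ (2/(N−1)) · ω(s,t). -/
/-- point-removal step (Young's trick). If `ω` is a control on `[a,b]`
and `s = p₀ < p₁ < ⋯ < p_N = t` is a partition of a subinterval `[s,t] ⊆ [a,b]`
with `N ≥ 2`, then there is an index `i ∈ {1, …, N−1}` with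
`ω(p_{i−1}, p_{i+1}) ≤ (2/(N−1)) · ω(s,t)`. -/
theorem control_point_removal
    (a b : ℝ) (ha : 0 ≤ a) (hab : a ≤ b)
    (ω : ℝ → ℝ → ℝ)
    (hωnn : ∀ s t, a ≤ s → s ≤ t → t ≤ b → 0 ≤ ω s t)
    (hωsuper : ∀ s r t, a ≤ s → s ≤ r → r ≤ t → t ≤ b → ω s r + ω r t ≤ ω s t)
    (s t : ℝ) (hs : a ≤ s) (ht : t ≤ b)
    (N : ℕ) (hN : 2 ≤ N) (p : ℕ → ℝ)
    (hp0 : p 0 = s) (hpN : p N = t)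
    (hpmono : ∀ i < N, p i < p (i + 1)) :
    ∃ i, 1 ≤ i ∧ i ≤ N - 1 ∧
      ω (p (i - 1)) (p (i + 1)) ≤ (2 / ((N : ℝ) - 1)) * ω s t := by
  have mono : ∀ j, j ≤ N → ∀ i, i ≤ j → p i ≤ p j := by
    intro j
    induction j with
    | zero =>
      intro _ i hi
      rw [Nat.le_zero.mp hi]
    | succ k ih =>
      intro hk i hi
      rcases Nat.lt_or_ge k i with h | h
      · have : i = k + 1 := by omega
        rw [this]
      · exact (ih (by omega) i h).trans (hpmono k (by omega)).le
  have lo : ∀ i, i ≤ N → a ≤ p i := fun i hi => by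
    have := mono i hi 0 (Nat.zero_le _)
    linarith
  have hi' : ∀ i, i ≤ N → p i ≤ b := fun i hi => by
    have := mono N le_rfl i hi
    linarith
  have key : ∀ n, n + 1 ≤ N →
      ∑ j ∈ Finset.range n, ω (p j) (p (j + 2)) ≤ ω (p 0) (p (n + 1)) + ω (p 0) (p n) := by
    intro n
    induction n with
    | zero =>
      intro h
      have h1 := hωnn (p 0) (p 1) (lo 0 (by omega)) (mono 1 h 0 (by omega)) (hi' 1 h)
      have h2 := hωnn (p 0) (p 0) (lo 0 (by omega)) le_rfl (hi' 0 (by omega))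
      simpa using add_nonneg h1 h2
    | succ n ih =>
      intro h
      rw [Finset.sum_range_succ]
      have h1 := ih (by omega)
      have h2 := hωsuper (p 0) (p n) (p (n + 2)) (lo 0 (by omega))
        (mono n (by omega) 0 (by omega)) (mono (n + 2) h n (by omega)) (hi' _ h)
      have e : n + 1 + 1 = n + 2 := rfl
      rw [e]
      linarith
  obtain ⟨n, rfl⟩ : ∃ n, N = n + 1 := ⟨N - 1, by omega⟩
  have hn : (0 : ℝ) < n := by
    have : 0 < n := by omega
    exact_mod_cast this
  have hk := key n le_rfl
  have h3 := hωsuper (p 0) (p n) (p (n + 1)) (lo 0 (by omega))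
    (mono n (by omega) 0 (by omega)) (mono (n + 1) le_rfl n (by omega)) (hi' _ le_rfl)
  have h4 := hωnn (p n) (p (n + 1)) (lo n (by omega))
    (mono (n + 1) le_rfl n (by omega)) (hi' _ le_rfl)
  rw [hp0, hpN] at hk h3
  rw [hpN] at h4
  by_contra hcon
  push Not at hcon
  have hlt : ∑ j ∈ Finset.range n, (2 / (n : ℝ)) * ω s t
      < ∑ j ∈ Finset.range n, ω (p j) (p (j + 2)) := by
    apply Finset.sum_lt_sum_of_nonempty
    · exact Finset.nonempty_range_iff.mpr (by omega)
    · intro j hj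
      have hj' := Finset.mem_range.mp hj
      have := hcon (j + 1) (by omega) (by omega)
      simpa using this
  rw [Finset.sum_const, Finset.card_range, nsmul_eq_mul] at hlt
  have e : (n : ℝ) * (2 / (n : ℝ) * ω s t) = 2 * ω s t := by
    field_simp
  rw [e] at hlt
  linarith
end

section
/- (Large-scale block decomposition estimate, paper equation (5-19).) Let T > 0, L ≥ 0, η ∈ (1/2, 1) and Δ ∈ (0, T]. Let h : [0,T] → ℝ^m be Borel measurable with |h(r)| ≤ L for almost every r, and set M_{s,t} := ∫_s^t h(r) dr for 0 ≤ s ≤ t ≤ T. Then for all 0 ≤ s ≤ t ≤ T with t − s > 2Δ, one has |M_{s,t}|² / (t−s)^{2η} ≤ 8 L² Δ^{2−2η} + 2 (t−s)^{1−2η} Δ^{−1} · Σ_{k=0}^{⌊T/Δ⌋−1} |M_{kΔ, (k+1)Δ}|². -/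
open MeasureTheory

/-- large-scale block decomposition estimate, paper equation (5-19).
If `|h(r)| ≤ L` a.e. on `[0,T]` and `M_{s,t} = ∫_s^t h(r) dr`, then for
`0 ≤ s ≤ t ≤ T` with `t − s > 2Δ`,
`|M_{s,t}|²/(t−s)^{2η} ≤ 8L²Δ^{2−2η} + 2(t−s)^{1−2η} Δ⁻¹ Σ_{k=0}^{⌊T/Δ⌋−1} |M_{kΔ,(k+1)Δ}|²`. -/
theorem large_scale_block_estimate
    (T L η Δ : ℝ) (hT : 0 < T) (hL : 0 ≤ L)
    (hη : 1 / 2 < η) (hη1 : η < 1) (hΔ0 : 0 < Δ) (hΔT : Δ ≤ T)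
    (m : ℕ) (h : ℝ → EuclideanSpace ℝ (Fin m)) (hmeas : Measurable h)
    (hbd : ∀ᵐ r ∂(volume.restrict (Set.Icc (0 : ℝ) T)), ‖h r‖ ≤ L) :
    ∀ s t, 0 ≤ s → s ≤ t → t ≤ T → 2 * Δ < t - s →
      ‖∫ r in s..t, h r‖ ^ 2 / (t - s) ^ (2 * η) ≤
        8 * L ^ 2 * Δ ^ (2 - 2 * η) +
          2 * (t - s) ^ (1 - 2 * η) * Δ⁻¹ *
            ∑ k ∈ Finset.range ⌊T / Δ⌋₊,
              ‖∫ r in ((k : ℝ) * Δ)..(((k : ℝ) + 1) * Δ), h r‖ ^ 2 := by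
  intro s t hs hst htT hd
  have hint : ∀ x y, 0 ≤ x → x ≤ y → y ≤ T → IntervalIntegrable h volume x y := by
    intro x y hx hxy hy
    rw [intervalIntegrable_iff_integrableOn_Icc_of_le hxy]
    have h1 : IntegrableOn h (Set.Icc 0 T) volume :=
      Measure.integrableOn_of_bounded (by simp) hmeas.aestronglyMeasurable hbd
    exact h1.mono_set (Set.Icc_subset_Icc hx hy)
  have hnb : ∀ x y, 0 ≤ x → x ≤ y → y ≤ T → ‖∫ r in x..y, h r‖ ≤ L * (y - x) := by
    intro x y hx hxy hy
    have := intervalIntegral.norm_integral_le_of_norm_le_const_ae (a := x) (b := y) (f := h)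
      (C := L) (by
        rw [ae_restrict_iff' measurableSet_Icc] at hbd
        filter_upwards [hbd] with r hr hr2
        rw [Set.uIoc_of_le hxy] at hr2
        exact hr ⟨hx.trans hr2.1.le, hr2.2.trans hy⟩)
    rwa [abs_of_nonneg (by linarith)] at this
  obtain ⟨a, ha1, ha2⟩ : ∃ a : ℕ, s ≤ a * Δ ∧ a * Δ ≤ s + Δ := by
    refine ⟨⌊s / Δ⌋₊ + 1, ?_, ?_⟩
    · have := (Nat.lt_floor_add_one (s / Δ)).le
      rw [div_le_iff₀ hΔ0] at this
      exact_mod_cast this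
    · have := Nat.floor_le (div_nonneg hs hΔ0.le)
      rw [le_div_iff₀ hΔ0] at this
      push_cast
      linarith
  have ht0 : 0 ≤ t := hs.trans hst
  obtain ⟨b, hb1, hb2, hb3⟩ : ∃ b : ℕ, b * Δ ≤ t ∧ t ≤ b * Δ + Δ ∧ b ≤ ⌊T / Δ⌋₊ := by
    refine ⟨⌊t / Δ⌋₊, ?_, ?_, ?_⟩
    · have := Nat.floor_le (div_nonneg ht0 hΔ0.le)
      rwa [le_div_iff₀ hΔ0] at this
    · have := (Nat.lt_floor_add_one (t / Δ)).le
      rw [div_le_iff₀ hΔ0] at this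
      linarith
    · gcongr
  have habΔ : (a : ℝ) * Δ ≤ b * Δ := by linarith
  have hab : a ≤ b := by exact_mod_cast le_of_mul_le_mul_right habΔ hΔ0
  have ha0 : 0 ≤ (a : ℝ) * Δ := by positivity
  set F : ℕ → EuclideanSpace ℝ (Fin m) :=
    fun k => ∫ r in ((k : ℝ) * Δ)..(((k : ℝ) + 1) * Δ), h r with hF
  have hB : ∫ r in (a * Δ)..(b * Δ), h r = ∑ k ∈ Finset.Ico a b, F k := by
    have := intervalIntegral.sum_integral_adjacent_intervals_Ico (f := h) (μ := volume)
      (a := fun k : ℕ => (k : ℝ) * Δ) hab (by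
        intro k hk
        have h2 : ((k + 1 : ℕ) : ℝ) ≤ b := by exact_mod_cast hk.2
        apply hint
        · positivity
        · gcongr
          simp
        · exact (mul_le_mul_of_nonneg_right h2 hΔ0.le).trans (hb1.trans htT))
    rw [← this]
    simp [hF]
  have hsplit : ∫ r in s..t, h r = (∫ r in s..(a * Δ), h r) + (∑ k ∈ Finset.Ico a b, F k)
      + ∫ r in (b * Δ)..t, h r := by
    rw [← hB, intervalIntegral.integral_add_adjacent_intervals,
      intervalIntegral.integral_add_adjacent_intervals]
    all_goals apply hint <;> linarith
  have hA := hnb s (a * Δ) hs ha1 (by linarith)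
  have hC := hnb (b * Δ) t (by linarith) hb1 htT
  have hA' : L * (a * Δ - s) ≤ L * Δ := mul_le_mul_of_nonneg_left (by linarith) hL
  have hC' : L * (t - b * Δ) ≤ L * Δ := mul_le_mul_of_nonneg_left (by linarith) hL
  set S := ∑ k ∈ Finset.range ⌊T / Δ⌋₊, ‖F k‖ ^ 2 with hS
  have hS0 : 0 ≤ S := by positivity
  have hBS : ‖∑ k ∈ Finset.Ico a b, F k‖ ^ 2 ≤ (t - s) * Δ⁻¹ * S := by
    calc ‖∑ k ∈ Finset.Ico a b, F k‖ ^ 2 ≤ (∑ k ∈ Finset.Ico a b, ‖F k‖) ^ 2 := by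
          gcongr
          exact norm_sum_le _ _
      _ ≤ (Finset.Ico a b).card * ∑ k ∈ Finset.Ico a b, ‖F k‖ ^ 2 := sq_sum_le_card_mul_sum_sq
      _ ≤ ((t - s) * Δ⁻¹) * S := by
          have h1 : ((Finset.Ico a b).card : ℝ) ≤ (t - s) * Δ⁻¹ := by
            rw [Nat.card_Ico, Nat.cast_sub hab, ← div_eq_mul_inv, le_div_iff₀ hΔ0]
            linarith
          have h2 : ∑ k ∈ Finset.Ico a b, ‖F k‖ ^ 2 ≤ S := by
            apply Finset.sum_le_sum_of_subset_of_nonneg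
            · intro k hk
              rw [Finset.mem_Ico] at hk
              exact Finset.mem_range.2 (by omega)
            · intros
              positivity
          exact mul_le_mul h1 h2 (by positivity) (by
            have : 0 ≤ t - s := by linarith
            positivity)
  have hM : ‖∫ r in s..t, h r‖ ^ 2 ≤ 8 * L ^ 2 * Δ ^ 2 + 2 * ((t - s) * Δ⁻¹ * S) := by
    have h1 : ‖∫ r in s..t, h r‖ ≤ 2 * (L * Δ) + ‖∑ k ∈ Finset.Ico a b, F k‖ := by
      rw [hsplit]
      refine norm_add₃_le.trans ?_
      linarith
    have h2 := pow_le_pow_left₀ (norm_nonneg _) h1 2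
    nlinarith [sq_nonneg (2 * (L * Δ) - ‖∑ k ∈ Finset.Ico a b, F k‖)]
  have hts : 0 < t - s := by linarith
  have hp : 0 < (t - s) ^ (2 * η) := Real.rpow_pos_of_pos hts _
  rw [div_le_iff₀ hp]
  have e1 : (t - s) ^ (1 - 2 * η) * (t - s) ^ (2 * η) = t - s := by
    rw [← Real.rpow_add hts]
    simp
  have e2 : Δ ^ (2 - 2 * η) * Δ ^ (2 * η) = Δ ^ 2 := by
    rw [← Real.rpow_add hΔ0]
    simp
  have e3 : Δ ^ (2 * η) ≤ (t - s) ^ (2 * η) :=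
    Real.rpow_le_rpow hΔ0.le (by linarith) (by linarith)
  have e4 : Δ ^ 2 ≤ Δ ^ (2 - 2 * η) * (t - s) ^ (2 * η) := by
    rw [← e2]
    gcongr
  calc _ ≤ _ := hM
    _ ≤ 8 * L ^ 2 * (Δ ^ (2 - 2 * η) * (t - s) ^ (2 * η))
        + 2 * (((t - s) ^ (1 - 2 * η) * (t - s) ^ (2 * η)) * Δ⁻¹ * S) := by
      rw [e1]
      gcongr
    _ = _ := by ring
end

section
/- (Hölder seminorm bound from block maxima, paper equation (5-20).) Let T > 0, L ≥ 0 and η ∈ (1/2, 1). There exists a constant C > 0, depending only on L and η, such that the following holds: for every Δ ∈ (0, T] and every Borel measurable h : [0,T] → ℝ^m with |h(r)| ≤ L for almost every r, setting M_{s,t} := ∫_s^t h(r) dr, one has sup_{0 ≤ s < t ≤ T} |M_{s,t}|² / (t−s)^{2η} ≤ C Δ^{2−2η} + C T Δ^{−(1+2η)} · max_{0 ≤ k ≤ ⌊T/Δ⌋−1} |M_{kΔ, (k+1)Δ}|². -/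
open MeasureTheory

/-- Hölder seminorm bound from block maxima, paper equation (5-20).
There is a constant `C > 0`, depending only on `L` and `η`, such that for every
`T > 0`, every `Δ ∈ (0,T]` and every `h` with `|h| ≤ L` a.e. on `[0,T]`, writing
`M_{s,t} = ∫_s^t h(r) dr`,
`sup_{0 ≤ s < t ≤ T} |M_{s,t}|²/(t−s)^{2η} ≤ C Δ^{2−2η} + C T Δ^{−(1+2η)} max_k |M_{kΔ,(k+1)Δ}|²`. -/
theorem hoelder_bound_from_block_maxima
    (L η : ℝ) (hL : 0 ≤ L) (hη : 1 / 2 < η) (hη1 : η < 1) :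
    ∃ C > (0 : ℝ), ∀ (T Δ : ℝ), 0 < T → 0 < Δ → Δ ≤ T →
      ∀ (m : ℕ) (h : ℝ → EuclideanSpace ℝ (Fin m)), Measurable h →
        (∀ᵐ r ∂(volume.restrict (Set.Icc (0 : ℝ) T)), ‖h r‖ ≤ L) →
        ∀ (hne : (Finset.range ⌊T / Δ⌋₊).Nonempty),
        ∀ s t, 0 ≤ s → s < t → t ≤ T →
          ‖∫ r in s..t, h r‖ ^ 2 / (t - s) ^ (2 * η) ≤
            C * Δ ^ (2 - 2 * η) +
              C * T * Δ ^ (-(1 + 2 * η)) *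
                (Finset.range ⌊T / Δ⌋₊).sup' hne
                  (fun k => ‖∫ r in ((k : ℝ) * Δ)..(((k : ℝ) + 1) * Δ), h r‖ ^ 2) := by
  refine ⟨8 * L ^ 2 + 2, by positivity, ?_⟩
  intro T Δ hT hΔ hΔT m h hmeas hbd hne s t hs hst ht
  have hbd' : ∀ᵐ r ∂(volume : Measure ℝ), r ∈ Set.Icc (0 : ℝ) T → ‖h r‖ ≤ L :=
    (ae_restrict_iff' measurableSet_Icc).1 hbd
  have hint0 : IntegrableOn h (Set.Icc 0 T) := by
    refine Measure.integrableOn_of_bounded (M := L) ?_ hmeas.aestronglyMeasurable hbd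
    simp
  have hint : ∀ a b : ℝ, 0 ≤ a → a ≤ b → b ≤ T → IntervalIntegrable h volume a b := by
    intro a b ha hab hb
    rw [intervalIntegrable_iff_integrableOn_Icc_of_le hab]
    exact hint0.mono_set (Set.Icc_subset_Icc ha hb)
  have hnorm : ∀ a b : ℝ, 0 ≤ a → a ≤ b → b ≤ T → ‖∫ r in a..b, h r‖ ≤ L * (b - a) := by
    intro a b ha hab hb
    have := intervalIntegral.norm_integral_le_of_norm_le_const_ae (a := a) (b := b) (f := h)
      (C := L) (by
        filter_upwards [hbd'] with r hr hr2
        rw [Set.uIoc_of_le hab] at hr2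
        exact hr ⟨by linarith [hr2.1], by linarith [hr2.2]⟩)
    rwa [abs_of_nonneg (by linarith)] at this
  set S := (Finset.range ⌊T / Δ⌋₊).sup' hne
                  (fun k => ‖∫ r in ((k : ℝ) * Δ)..(((k : ℝ) + 1) * Δ), h r‖ ^ 2) with hS
  have hle : ∀ k ∈ Finset.range ⌊T / Δ⌋₊,
      ‖∫ r in ((k : ℝ) * Δ)..(((k : ℝ) + 1) * Δ), h r‖ ^ 2 ≤ S := fun k hk =>
    Finset.le_sup' (fun k : ℕ => ‖∫ r in ((k : ℝ) * Δ)..(((k : ℝ) + 1) * Δ), h r‖ ^ 2) hk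
  have hS0 : 0 ≤ S := by
    obtain ⟨k, hk⟩ := hne
    exact (sq_nonneg _).trans (hle k hk)
  clear_value S
  set u := t - s with hu
  have hu0 : 0 < u := by rw [hu]; linarith
  have huT : u ≤ T := by rw [hu]; linarith
  have hup : 0 < u ^ (2 * η) := Real.rpow_pos_of_pos hu0 _
  have hD1 : 0 < Δ ^ (2 - 2 * η) := Real.rpow_pos_of_pos hΔ _
  have hD2 : 0 < Δ ^ (-(1 + 2 * η)) := Real.rpow_pos_of_pos hΔ _
  have husplit : u ^ 2 = u ^ (2 - 2 * η) * u ^ (2 * η) := by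
    rw [← Real.rpow_add hu0, ← Real.rpow_natCast]; congr 1; push_cast; ring
  rw [div_le_iff₀ hup]
  rcases lt_or_ge u Δ with hlt | hge
  · have h1 : ‖∫ r in s..t, h r‖ ^ 2 ≤ (L * u) ^ 2 :=
      pow_le_pow_left₀ (norm_nonneg _) (hnorm s t hs hst.le ht) 2
    have h2 : u ^ (2 - 2 * η) ≤ Δ ^ (2 - 2 * η) :=
      Real.rpow_le_rpow hu0.le hlt.le (by linarith)
    calc _ ≤ (L * u) ^ 2 := h1
      _ = L ^ 2 * u ^ (2 - 2 * η) * u ^ (2 * η) := by rw [mul_pow, husplit]; ring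
      _ ≤ _ := by
        gcongr
        have h3 : L ^ 2 * u ^ (2 - 2 * η) ≤ (8 * L ^ 2 + 2) * Δ ^ (2 - 2 * η) := by
          gcongr
          nlinarith [sq_nonneg L]
        have : 0 ≤ (8 * L ^ 2 + 2) * T * Δ ^ (-(1 + 2 * η)) * S := by positivity
        linarith
  · set i := ⌈s / Δ⌉₊ with hi
    set j := ⌊t / Δ⌋₊ with hj
    have hi1 : s ≤ i * Δ := (div_le_iff₀ hΔ).1 (Nat.le_ceil _)
    have hi2 : i * Δ < s + Δ := by
      have := Nat.ceil_lt_add_one (div_nonneg hs hΔ.le)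
      rw [← hi] at this
      have h3 := mul_lt_mul_of_pos_right this hΔ
      rwa [add_mul, div_mul_cancel₀ _ hΔ.ne', one_mul] at h3
    have ht0 : 0 ≤ t := by linarith
    have hj1 : j * Δ ≤ t := (le_div_iff₀ hΔ).1 (Nat.floor_le (div_nonneg ht0 hΔ.le))
    have hj2 : t < j * Δ + Δ := by
      have := (div_lt_iff₀ hΔ).1 (Nat.lt_floor_add_one (t / Δ))
      rw [← hj] at this
      linarith
    have hij : i ≤ j := Nat.le_floor ((le_div_iff₀ hΔ).2 (by linarith))
    have hijR : (i : ℝ) * Δ ≤ j * Δ := by gcongr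
    have hjn : j ≤ ⌊T / Δ⌋₊ := Nat.floor_mono (by gcongr)
    have hjT : (j : ℝ) * Δ ≤ T := by linarith
    have hiN : 0 ≤ (i : ℝ) * Δ := by positivity
    have hsum := intervalIntegral.sum_integral_adjacent_intervals_Ico (f := h) (μ := volume)
      (a := fun k : ℕ => (k : ℝ) * Δ) hij (by
        intro k hk
        have hk2 : ((k + 1 : ℕ) : ℝ) * Δ ≤ j * Δ := by
          have : k + 1 ≤ j := hk.2
          gcongr
        exact hint _ _ (by positivity) (by push_cast; linarith) (by linarith))
    have hA := intervalIntegral.integral_add_adjacent_intervals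
      (hint s (i * Δ) hs hi1 (by linarith)) (hint (i * Δ) (j * Δ) hiN hijR hjT)
    have hB := intervalIntegral.integral_add_adjacent_intervals
      (hint s (j * Δ) hs (by linarith) hjT) (hint (j * Δ) t (by linarith) hj1 ht)
    have hmid : ‖∫ r in (i * Δ)..(j * Δ), h r‖ ≤ (u / Δ) * √S := by
      rw [← hsum]
      calc _ ≤ ∑ k ∈ Finset.Ico i j, √S := by
            refine norm_sum_le_of_le _ fun k hk => ?_
            push_cast
            refine Real.le_sqrt_of_sq_le (hle k ?_)
            rw [Finset.mem_Ico] at hk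
            exact Finset.mem_range.2 (by omega)
        _ = ((j : ℝ) - i) * √S := by
            rw [Finset.sum_const, Nat.card_Ico, nsmul_eq_mul, Nat.cast_sub hij]
        _ ≤ _ := by
            gcongr
            rw [le_div_iff₀ hΔ]
            linarith
    have hl := hnorm s (i * Δ) hs hi1 (by linarith)
    have hr := hnorm (j * Δ) t (by linarith) hj1 ht
    have hl' : L * (i * Δ - s) ≤ L * Δ := by gcongr; linarith
    have hr' : L * (t - j * Δ) ≤ L * Δ := by gcongr; linarith
    have htot : ‖∫ r in s..t, h r‖ ≤ 2 * (L * Δ) + (u / Δ) * √S := by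
      rw [← hB, ← hA]
      refine (norm_add₃_le).trans ?_
      linarith
    have hsq : ‖∫ r in s..t, h r‖ ^ 2 ≤ 8 * L ^ 2 * Δ ^ 2 + 2 * (u ^ 2 / Δ ^ 2 * S) := by
      have h1 := pow_le_pow_left₀ (norm_nonneg _) htot 2
      have h2 : (u / Δ * √S) ^ 2 = u ^ 2 / Δ ^ 2 * S := by
        rw [mul_pow, Real.sq_sqrt hS0, div_pow]
      nlinarith [sq_nonneg (2 * (L * Δ) - (u / Δ) * √S)]
    have e1 : Δ ^ 2 ≤ Δ ^ (2 - 2 * η) * u ^ (2 * η) := by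
      have : Δ ^ 2 = Δ ^ (2 - 2 * η) * Δ ^ (2 * η) := by
        rw [← Real.rpow_add hΔ, ← Real.rpow_natCast]; congr 1; push_cast; ring
      rw [this]
      gcongr
    have e2 : u ^ 2 / Δ ^ 2 ≤ T * Δ ^ (-(1 + 2 * η)) * u ^ (2 * η) := by
      have a1 : u ^ (2 - 2 * η) = u * u ^ (1 - 2 * η) := by
        nth_rewrite 2 [← Real.rpow_one u]
        rw [← Real.rpow_add hu0]; congr 1; ring
      have a2 : u ^ (1 - 2 * η) ≤ Δ ^ (1 - 2 * η) :=
        Real.rpow_le_rpow_of_nonpos hΔ hge (by linarith)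
      have a3 : Δ ^ (1 - 2 * η) = Δ ^ (-(1 + 2 * η)) * Δ ^ 2 := by
        rw [← Real.rpow_natCast, ← Real.rpow_add hΔ]; congr 1; push_cast; ring
      rw [div_le_iff₀ (by positivity), husplit, a1]
      calc _ ≤ T * Δ ^ (1 - 2 * η) * u ^ (2 * η) := by gcongr
        _ = _ := by rw [a3]; ring
    have f1 : 8 * L ^ 2 * Δ ^ 2 ≤ (8 * L ^ 2 + 2) * (Δ ^ (2 - 2 * η) * u ^ (2 * η)) := by
      gcongr; linarith
    have f2 : 2 * (u ^ 2 / Δ ^ 2 * S) ≤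
        (8 * L ^ 2 + 2) * (T * Δ ^ (-(1 + 2 * η)) * u ^ (2 * η) * S) := by
      gcongr
      exact le_add_of_nonneg_left (by positivity)
    calc _ ≤ _ := hsq
      _ ≤ _ := add_le_add f1 f2
      _ = _ := by ring
end
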